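/- A matrix representation of the chain quiver with vertices 1,…,t (with an arbitrary fixed orientation of the arrows) over ℂ is indecomposable if and only if it is isomorphic to L_{ij} for some 1 ≤ i ≤ j ≤ t. -/

import Mathlib

open Matrix

namespace ChainQuiver

/-! The chain quiver has vertices `0, 1, …, m` (i.e. `t = m + 1` vertices) and arrows
`α_i` joining vertices `i` and `i+1` for `i = 0, …, m - 1`.  The orientation is given
by `ε : Fin m → Bool`: `ε i = true` means `α_i : i → i+1`, and `ε i = false` means
`α_i : i+1 → i`. -/

/-- Source vertex of the arrow `α_i`. -/
def src {m : ℕ} (ε : Fin m → Bool) (i : Fin m) : Fin (m + 1) :=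
  if ε i then i.castSucc else i.succ

/-- Target vertex of the arrow `α_i`. -/
def tgt {m : ℕ} (ε : Fin m → Bool) (i : Fin m) : Fin (m + 1) :=
  if ε i then i.succ else i.castSucc

/-- A matrix representation of the chain quiver: a dimension at each vertex and, for
each arrow, a (target-dim) × (source-dim) complex matrix. -/
structure Rep (m : ℕ) (ε : Fin m → Bool) where
  d : Fin (m + 1) → ℕ
  A : ∀ i : Fin m, Matrix (Fin (d (tgt ε i))) (Fin (d (src ε i))) ℂ

variable {m : ℕ} {ε : Fin m → Bool}

/-- Isomorphism of representations: invertible matrices `S v` (with two-sided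
inverses `T v`) at each vertex with `Y.A i = S (tgt i) * X.A i * (S (src i))⁻¹`. -/
def Iso (X Y : Rep m ε) : Prop :=
  ∃ (S : ∀ v, Matrix (Fin (Y.d v)) (Fin (X.d v)) ℂ)
    (T : ∀ v, Matrix (Fin (X.d v)) (Fin (Y.d v)) ℂ),
    (∀ v, S v * T v = 1) ∧ (∀ v, T v * S v = 1) ∧
    ∀ i, Y.A i = S (tgt ε i) * X.A i * T (src ε i)

/-- Arrow-wise block-diagonal direct sum of representations. -/
noncomputable def dsum (X Y : Rep m ε) : Rep m ε where
  d v := X.d v + Y.d v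
  A i := Matrix.reindex finSumFinEquiv finSumFinEquiv
    (Matrix.fromBlocks (X.A i) 0 0 (Y.A i))

/-- The zero representation. -/
def zero (m : ℕ) (ε : Fin m → Bool) : Rep m ε := ⟨fun _ => 0, fun _ => 0⟩

/-- Direct sum of a list of representations. -/
noncomputable def dsumList (L : List (Rep m ε)) : Rep m ε := L.foldr dsum (zero m ε)

/-- The indecomposable representation `L_{ij}` (for `i ≤ j`): dimension `1` at the
vertices `i, …, j` and `0` elsewhere; the matrices between consecutive vertices of
`{i, …, j}` are `1 × 1` identities and all other matrices are empty. -/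
def interval (ε : Fin m → Bool) (i j : Fin (m + 1)) : Rep m ε where
  d v := if i ≤ v ∧ v ≤ j then 1 else 0
  A _ := Matrix.of fun _ _ => 1

/-- A representation is nonzero if some vertex has nonzero dimension. -/
def Nonzero (X : Rep m ε) : Prop := ∃ v, X.d v ≠ 0

/-- Indecomposability: nonzero and not isomorphic to a direct sum of two nonzero
representations. -/
def Indecomposable (X : Rep m ε) : Prop :=
  Nonzero X ∧ ¬ ∃ Y Z : Rep m ε, Nonzero Y ∧ Nonzero Z ∧ Iso X (dsum Y Z)

end ChainQuiver

namespace ChainQuiver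

section Abstract

variable {m : ℕ} {V : Fin (m+1) → Type} [∀ v, AddCommGroup (V v)] [∀ v, Module ℂ (V v)]

/-- Families compatible along all edges of `[p,n]`. -/
def Cn (D : Fin m → Submodule ℂ (∀ v, V v)) (p n : ℕ) : Submodule ℂ (∀ v, V v) :=
  ⨅ i : Fin m, ⨅ (_ : p ≤ i.val ∧ i.val + 1 ≤ n), D i

theorem mem_Cn (D : Fin m → Submodule ℂ (∀ v, V v)) (p n : ℕ) (x : ∀ v, V v) :
    x ∈ Cn D p n ↔ ∀ i : Fin m, p ≤ i.val → i.val + 1 ≤ n → x ∈ D i := by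
  simp [Cn, Submodule.mem_iInf]

theorem factor {W U : Type} [AddCommGroup W] [Module ℂ W] [AddCommGroup U] [Module ℂ U]
    (h : W →ₗ[ℂ] U) (ω : Module.Dual ℂ W) (H : ∀ w, h w = 0 → ω w = 0) :
    ∃ φ : Module.Dual ℂ U, ∀ w, φ (h w) = ω w := by
  have : ω ∈ LinearMap.range h.dualMap := by
    rw [LinearMap.range_dualMap_eq_dualAnnihilator_ker, Submodule.mem_dualAnnihilator]
    intro w hw
    exact H w hw
  obtain ⟨φ, rfl⟩ := this
  exact ⟨φ, fun w => rfl⟩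

/-- Extension of functionals. -/
theorem extend_dual (D : Fin m → Submodule ℂ (∀ v, V v))
    (hD : ∀ i, ∀ w ∈ D i, ∀ w' : (∀ v, V v), w' i.castSucc = w i.castSucc →
      w' i.succ = w i.succ → w' ∈ D i)
    (p : ℕ) (hp : p < m + 1) (n : ℕ) (hpn : p ≤ n) : ∀ (hn : n < m + 1)
    (φp : Module.Dual ℂ (V ⟨p, hp⟩)) (φn : Module.Dual ℂ (V ⟨n, hn⟩)),
    (∀ x ∈ Cn D p n, φp (x ⟨p, hp⟩) = φn (x ⟨n, hn⟩)) →
    ∃ ψ : ∀ v, Module.Dual ℂ (V v), ψ ⟨p, hp⟩ = φp ∧ ψ ⟨n, hn⟩ = φn ∧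
      ∀ i : Fin m, p ≤ i.val → i.val + 1 ≤ n → ∀ w ∈ D i,
        ψ i.castSucc (w i.castSucc) = ψ i.succ (w i.succ) := by
  induction n, hpn using Nat.le_induction with
  | base =>
    intro hn φp φn h
    refine ⟨Function.update 0 ⟨p, hp⟩ φp, by simp, ?_, ?_⟩
    · simp only [Function.update_self]
      ext u
      have := h (Pi.single ⟨p, hp⟩ u) (by rw [mem_Cn]; intros; omega)
      simpa using this
    · intros; omega
  | succ n hpn ih =>
    intro hn φp φn h
    have hnm : n < m := by omega
    let k : Fin m := ⟨n, hnm⟩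
    let hW : (Cn D p n × D k) →ₗ[ℂ] V k.castSucc :=
      ((LinearMap.proj (R := ℂ) (φ := V) k.castSucc).comp (Cn D p n).subtype).comp
          (LinearMap.fst ℂ _ _)
        - ((LinearMap.proj (R := ℂ) (φ := V) k.castSucc).comp (D k).subtype).comp
          (LinearMap.snd ℂ _ _)
    let ω : (Cn D p n × D k) →ₗ[ℂ] ℂ :=
      (φp.comp ((LinearMap.proj (R := ℂ) (φ := V) ⟨p, hp⟩).comp (Cn D p n).subtype)).comp
          (LinearMap.fst ℂ _ _)
        - (φn.comp ((LinearMap.proj (R := ℂ) (φ := V) k.succ).comp (D k).subtype)).comp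
          (LinearMap.snd ℂ _ _)
    have hWa : ∀ x w, hW (x, w) = x.1 k.castSucc - w.1 k.castSucc := fun _ _ => rfl
    have ωa : ∀ x w, ω (x, w) = φp (x.1 ⟨p, hp⟩) - φn (w.1 k.succ) := fun _ _ => rfl
    obtain ⟨φk, hk⟩ := factor hW ω (by
      rintro ⟨⟨x, hx⟩, ⟨w, hw⟩⟩ h0
      rw [hWa] at h0
      rw [ωa]
      simp only at h0 ⊢
      rw [sub_eq_zero] at h0 ⊢
      have hx' : Function.update x k.succ (w k.succ) ∈ Cn D p (n+1) := by
        rw [mem_Cn] at hx ⊢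
        intro i hi hin
        by_cases hik : i.val = n
        · obtain rfl : i = k := Fin.ext hik
          refine hD _ w hw _ ?_ ?_
          · rw [Function.update_of_ne (by simp [Fin.ext_iff]), h0]
          · simp
        · refine hD _ x (hx i hi (by omega)) _ ?_ ?_
          · rw [Function.update_of_ne (by simp [Fin.ext_iff, k]; omega)]
          · rw [Function.update_of_ne (by simp [Fin.ext_iff, k]; omega)]
      have := h _ hx'
      rw [Function.update_of_ne (by simp [Fin.ext_iff, k]; omega)] at this
      rw [this]
      exact congrArg φn (Function.update_self _ _ _))
    obtain ⟨ψ, h1, h2, h3⟩ := ih (by omega) φp φk (by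
      intro x hx
      have := hk (⟨x, hx⟩, 0)
      rw [hWa, ωa] at this
      simp only [ZeroMemClass.coe_zero, Pi.zero_apply, sub_zero, map_zero] at this
      exact this.symm)
    have hd : ∀ w ∈ D k, φk (w k.castSucc) = φn (w k.succ) := by
      intro w hw
      have := hk (0, ⟨w, hw⟩)
      rw [hWa, ωa] at this
      simpa using this
    refine ⟨Function.update ψ k.succ φn, ?_, Function.update_self _ _ _, ?_⟩
    · rw [Function.update_of_ne (by simp [Fin.ext_iff, k]; omega), h1]
    · intro i hi hin w hw
      by_cases hik : i.val = n
      · obtain rfl : i = k := Fin.ext hik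
        rw [Function.update_of_ne (by simp [Fin.ext_iff]), Function.update_self, ← hd w hw]
        exact congrArg (fun φ : Module.Dual ℂ _ => φ (w k.castSucc)) h2
      · rw [Function.update_of_ne (by simp [Fin.ext_iff, k]; omega),
          Function.update_of_ne (by simp [Fin.ext_iff, k]; omega)]
        exact h3 i hi (by omega) w hw

theorem extend_dual' (D : Fin m → Submodule ℂ (∀ v, V v))
    (hD : ∀ i, ∀ w ∈ D i, ∀ w' : (∀ v, V v), w' i.castSucc = w i.castSucc →
      w' i.succ = w i.succ → w' ∈ D i)
    (p : ℕ) (hp : p < m + 1) (n : ℕ) (hpn : p ≤ n) (hn : n < m + 1)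
    (φp : Module.Dual ℂ (V ⟨p, hp⟩))
    (h : ∀ x ∈ Cn D p n, x ⟨n, hn⟩ = 0 → φp (x ⟨p, hp⟩) = 0) :
    ∃ ψ : ∀ v, Module.Dual ℂ (V v), ψ ⟨p, hp⟩ = φp ∧
      ∀ i : Fin m, p ≤ i.val → i.val + 1 ≤ n → ∀ w ∈ D i,
        ψ i.castSucc (w i.castSucc) = ψ i.succ (w i.succ) := by
  obtain ⟨φn, hφ⟩ := factor
    ((LinearMap.proj (R := ℂ) (φ := V) ⟨n, hn⟩).comp (Cn D p n).subtype)
    (φp.comp ((LinearMap.proj (R := ℂ) (φ := V) ⟨p, hp⟩).comp (Cn D p n).subtype))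
    (fun w hw => h w.1 w.2 hw)
  obtain ⟨ψ, h1, _, h3⟩ := extend_dual D hD p hp n hpn hn φp φn
    (fun x hx => (hφ ⟨x, hx⟩).symm)
  exact ⟨ψ, h1, h3⟩

/-- Functional killing a submodule and taking the value `1` on a vector outside. -/
theorem sep {U : Type} [AddCommGroup U] [Module ℂ U] (K : Submodule ℂ U) (u : U) (hu : u ∉ K) :
    ∃ φ : Module.Dual ℂ U, φ u = 1 ∧ ∀ k ∈ K, φ k = 0 := by
  obtain ⟨f, hf, hK⟩ := Submodule.exists_le_ker_of_notMem hu
  refine ⟨(f u)⁻¹ • f, by simp [hf], fun k hk => ?_⟩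
  have : f k = 0 := hK hk
  simp [this]

end Abstract

end ChainQuiver

namespace ChainQuiver

theorem idem_factor {d : ℕ} (e : Matrix (Fin d) (Fin d) ℂ) (he : e * e = e) :
    ∃ (r : ℕ) (P : Matrix (Fin r) (Fin d) ℂ) (Q : Matrix (Fin d) (Fin r) ℂ),
      P * Q = 1 ∧ Q * P = e := by
  let f := Matrix.toLin' e
  let R := LinearMap.range f
  let b := Module.finBasis ℂ R
  let ι : R ≃ₗ[ℂ] (Fin (Module.finrank ℂ R) → ℂ) := b.equivFun
  let P' : (Fin d → ℂ) →ₗ[ℂ] (Fin (Module.finrank ℂ R) → ℂ) := ι.toLinearMap.comp f.rangeRestrict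
  let Q' : (Fin (Module.finrank ℂ R) → ℂ) →ₗ[ℂ] (Fin d → ℂ) := R.subtype.comp ι.symm.toLinearMap
  have hff : ∀ w, f (f w) = f w := by
    intro w
    simp [f, Matrix.mulVec_mulVec, he]
  refine ⟨Module.finrank ℂ R, LinearMap.toMatrix' P', LinearMap.toMatrix' Q', ?_, ?_⟩
  · rw [← LinearMap.toMatrix'_comp]
    have : P' ∘ₗ Q' = LinearMap.id := by
      apply LinearMap.ext
      intro w
      have h : f.rangeRestrict (ι.symm w : Fin d → ℂ) = ι.symm w := by
        apply Subtype.ext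
        obtain ⟨u, hu⟩ := (ι.symm w).2
        change f (ι.symm w : Fin d → ℂ) = (ι.symm w : Fin d → ℂ)
        rw [← hu, hff]
      change ι (f.rangeRestrict (ι.symm w : Fin d → ℂ)) = w
      rw [h, LinearEquiv.apply_symm_apply]
    rw [this, LinearMap.toMatrix'_id]
  · rw [← LinearMap.toMatrix'_comp]
    have : Q' ∘ₗ P' = f := by
      apply LinearMap.ext
      intro w
      change ((ι.symm (ι (f.rangeRestrict w)) : R) : Fin d → ℂ) = f w
      rw [LinearEquiv.symm_apply_apply]
      rfl
    rw [this]
    simp [f]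

theorem blk1 {r r' d : ℕ} (P : Matrix (Fin r) (Fin d) ℂ) (P' : Matrix (Fin r') (Fin d) ℂ)
    (Q : Matrix (Fin d) (Fin r) ℂ) (Q' : Matrix (Fin d) (Fin r') ℂ)
    (h1 : P * Q = 1) (h2 : P' * Q' = 1) (h3 : P * Q' = 0) (h4 : P' * Q = 0) :
    Matrix.reindex finSumFinEquiv (Equiv.refl _) (Matrix.fromRows P P') *
      Matrix.reindex (Equiv.refl _) finSumFinEquiv (Matrix.fromCols Q Q') = 1 := by
  simp only [Matrix.reindex_apply, Equiv.refl_symm]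
  rw [Matrix.submatrix_mul_equiv _ _ _ (Equiv.refl _) _, Matrix.fromRows_mul_fromCols,
    h1, h2, h3, h4, Matrix.fromBlocks_one]
  exact Matrix.submatrix_one_equiv _

theorem blk2 {r r' d : ℕ} (P : Matrix (Fin r) (Fin d) ℂ) (P' : Matrix (Fin r') (Fin d) ℂ)
    (Q : Matrix (Fin d) (Fin r) ℂ) (Q' : Matrix (Fin d) (Fin r') ℂ)
    (e : Matrix (Fin d) (Fin d) ℂ) (h1 : Q * P = e) (h2 : Q' * P' = 1 - e) :
    Matrix.reindex (Equiv.refl _) finSumFinEquiv (Matrix.fromCols Q Q') *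
      Matrix.reindex finSumFinEquiv (Equiv.refl _) (Matrix.fromRows P P') = 1 := by
  simp only [Matrix.reindex_apply, Equiv.refl_symm]
  rw [Matrix.submatrix_mul_equiv, Matrix.fromCols_mul_fromRows, h1, h2]
  simp

theorem blk3 {r r' d s s' c : ℕ} (P : Matrix (Fin r) (Fin d) ℂ) (P' : Matrix (Fin r') (Fin d) ℂ)
    (A : Matrix (Fin d) (Fin c) ℂ)
    (Q : Matrix (Fin c) (Fin s) ℂ) (Q' : Matrix (Fin c) (Fin s') ℂ)
    (h1 : P * A * Q' = 0) (h2 : P' * A * Q = 0) :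
    Matrix.reindex finSumFinEquiv finSumFinEquiv
      (Matrix.fromBlocks (P * A * Q) 0 0 (P' * A * Q')) =
    Matrix.reindex finSumFinEquiv (Equiv.refl _) (Matrix.fromRows P P') * A *
      Matrix.reindex (Equiv.refl _) finSumFinEquiv (Matrix.fromCols Q Q') := by
  simp only [Matrix.reindex_apply, Equiv.refl_symm]
  have : A = A.submatrix (Equiv.refl _) (Equiv.refl _) := by simp
  conv_rhs => rw [this]
  rw [Matrix.submatrix_mul_equiv _ _ _ (Equiv.refl _) _,
    Matrix.submatrix_mul_equiv _ _ _ (Equiv.refl _) _, Matrix.fromRows_mul,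
    Matrix.fromRows_mul_fromCols, h1, h2]

theorem blk4 {a b c d : ℕ} (A : Matrix (Fin a) (Fin c) ℂ) (B : Matrix (Fin b) (Fin d) ℂ)
    (h1 : a = 0 ∨ c = 0) (h2 : b = 0 ∨ d = 0) :
    Matrix.reindex finSumFinEquiv finSumFinEquiv (Matrix.fromBlocks A 0 0 B) = 0 := by
  have hA : A = 0 := by
    ext x y; have := x.2; have := y.2; omega
  have hB : B = 0 := by
    ext x y; have := x.2; have := y.2; omega
  rw [hA, hB, Matrix.fromBlocks_zero]
  rfl

variable {m : ℕ} {ε : Fin m → Bool}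

theorem idem_split (X : Rep m ε) (hX : Indecomposable X)
    (e : ∀ v, Matrix (Fin (X.d v)) (Fin (X.d v)) ℂ) (he : ∀ v, e v * e v = e v)
    (hc : ∀ i, e (tgt ε i) * X.A i = X.A i * e (src ε i)) (hne : ∃ v, e v ≠ 0) :
    ∀ v, e v = 1 := by
  by_contra hcon
  push Not at hcon
  obtain ⟨v1, hv1⟩ := hcon
  obtain ⟨v0, hv0⟩ := hne
  have he' : ∀ v, (1 - e v) * (1 - e v) = 1 - e v := by
    intro v
    have := he v
    simp [mul_sub, sub_mul, this]
  choose r P Q hPQ hQP using fun v => idem_factor (e v) (he v)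
  choose r' P' Q' hPQ' hQP' using fun v => idem_factor (1 - e v) (he' v)
  have hPe : ∀ v, P v = P v * e v := fun v => by
    rw [← hQP, ← Matrix.mul_assoc, hPQ, Matrix.one_mul]
  have hPe' : ∀ v, P' v = P' v * (1 - e v) := fun v => by
    rw [← hQP', ← Matrix.mul_assoc, hPQ', Matrix.one_mul]
  have hQe : ∀ v, Q v = e v * Q v := fun v => by
    rw [← hQP, Matrix.mul_assoc, hPQ, Matrix.mul_one]
  have hQe' : ∀ v, Q' v = (1 - e v) * Q' v := fun v => by
    rw [← hQP', Matrix.mul_assoc, hPQ', Matrix.mul_one]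
  have z1 : ∀ v, e v * (1 - e v) = 0 := fun v => by rw [mul_sub, he, mul_one, sub_self]
  have z2 : ∀ v, (1 - e v) * e v = 0 := fun v => by rw [sub_mul, he, one_mul, sub_self]
  have hPQ1 : ∀ v, P v * Q' v = 0 := fun v => by
    rw [hPe, hQe', Matrix.mul_assoc, ← Matrix.mul_assoc (e v), z1]; simp
  have hPQ2 : ∀ v, P' v * Q v = 0 := fun v => by
    rw [hPe', hQe, Matrix.mul_assoc, ← Matrix.mul_assoc (1 - e v), z2]; simp
  have hA1 : ∀ i, P (tgt ε i) * X.A i * Q' (src ε i) = 0 := fun i => by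
    rw [hPe, hQe', Matrix.mul_assoc (P _), hc, ← Matrix.mul_assoc, ← Matrix.mul_assoc,
      Matrix.mul_assoc _ (e (src ε i)), z1]; simp
  have hc' : ∀ i, (1 - e (tgt ε i)) * X.A i = X.A i * (1 - e (src ε i)) := fun i => by
    rw [Matrix.sub_mul, Matrix.mul_sub, hc]; simp
  have hA2 : ∀ i, P' (tgt ε i) * X.A i * Q (src ε i) = 0 := fun i => by
    rw [hPe', hQe, Matrix.mul_assoc (P' _), hc', ← Matrix.mul_assoc, ← Matrix.mul_assoc,
      Matrix.mul_assoc _ (1 - e (src ε i)), z2]; simp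
  apply hX.2
  refine ⟨⟨r, fun i => P (tgt ε i) * X.A i * Q (src ε i)⟩,
    ⟨r', fun i => P' (tgt ε i) * X.A i * Q' (src ε i)⟩, ⟨v0, ?_⟩, ⟨v1, ?_⟩, ?_⟩
  · intro h0
    apply hv0
    change r v0 = 0 at h0
    have : IsEmpty (Fin (r v0)) := by rw [h0]; infer_instance
    rw [← hQP]
    ext a b
    simp [Matrix.mul_apply]
  · intro h0
    apply hv1
    change r' v1 = 0 at h0
    have : IsEmpty (Fin (r' v1)) := by rw [h0]; infer_instance
    have h2 : 1 - e v1 = 0 := by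
      rw [← hQP']
      ext a b
      simp [Matrix.mul_apply]
    exact (sub_eq_zero.mp h2).symm
  · refine ⟨fun v => Matrix.reindex finSumFinEquiv (Equiv.refl _) (Matrix.fromRows (P v) (P' v)),
      fun v => Matrix.reindex (Equiv.refl _) finSumFinEquiv (Matrix.fromCols (Q v) (Q' v)),
      ?_, ?_, ?_⟩
    · exact fun v => blk1 _ _ _ _ (hPQ v) (hPQ' v) (hPQ1 v) (hPQ2 v)
    · exact fun v => blk2 _ _ _ _ (e v) (hQP v) (hQP' v)
    · exact fun i => blk3 _ _ _ _ _ (hA1 i) (hA2 i)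

theorem dim_eq {a b : ℕ} (S : Matrix (Fin a) (Fin b) ℂ) (T : Matrix (Fin b) (Fin a) ℂ)
    (h1 : S * T = 1) (h2 : T * S = 1) : a = b := by
  have := Matrix.square_of_invertible S T h1 h2
  simpa using this

theorem src_tgt (i : Fin m) : (src ε i = i.castSucc ∧ tgt ε i = i.succ) ∨
    (src ε i = i.succ ∧ tgt ε i = i.castSucc) := by
  unfold src tgt
  cases ε i <;> simp

theorem interval_indec (X : Rep m ε) (i j : Fin (m+1)) (hij : i ≤ j)
    (h : Iso X (interval ε i j)) : Indecomposable X := by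
  obtain ⟨S, T, hST, hTS, hA⟩ := h
  have hd : ∀ v, (interval ε i j).d v = X.d v := fun v => dim_eq _ _ (hST v) (hTS v)
  refine ⟨⟨i, ?_⟩, ?_⟩
  · rw [← hd]; simp [interval, hij]
  rintro ⟨Y, Z, ⟨v1, hY⟩, ⟨v2, hZ⟩, S', T', hST', hTS', hA'⟩
  have hd' : ∀ v, Y.d v + Z.d v = if i ≤ v ∧ v ≤ j then 1 else 0 := fun v => by
    have h1 : Y.d v + Z.d v = X.d v := dim_eq _ _ (hST' v) (hTS' v)
    rw [h1, ← hd]; rfl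
  have hv1 : i ≤ v1 ∧ v1 ≤ j := by
    by_contra hh
    have := hd' v1
    rw [if_neg hh] at this
    omega
  have hv2 : i ≤ v2 ∧ v2 ≤ j := by
    by_contra hh
    have := hd' v2
    rw [if_neg hh] at this
    omega
  have key : ∀ k : Fin m, (i ≤ src ε k ∧ src ε k ≤ j) → (i ≤ tgt ε k ∧ tgt ε k ≤ j) →
      Y.d (src ε k) = Y.d (tgt ε k) := by
    intro k hs ht
    by_contra hne
    have ds := hd' (src ε k)
    have dt := hd' (tgt ε k)
    rw [if_pos hs] at ds
    rw [if_pos ht] at dt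
    have hz : (dsum Y Z).A k = 0 := blk4 _ _ (by omega) (by omega)
    have hX0 : X.A k = 0 := by
      have h1 : T' (tgt ε k) * (dsum Y Z).A k * S' (src ε k) = X.A k := by
        rw [hA', Matrix.mul_assoc, Matrix.mul_assoc, hTS', Matrix.mul_one, ← Matrix.mul_assoc,
          hTS', Matrix.one_mul]
      rw [← h1, hz]; simp
    have h2 := hA k
    rw [hX0, Matrix.mul_zero, Matrix.zero_mul] at h2
    have h3 := congrFun (congrFun h2 ⟨0, by simp [interval, ht]⟩) ⟨0, by simp [interval, hs]⟩
    exact one_ne_zero (α := ℂ) h3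
  have const : ∀ n (hn : n < m + 1), i.val ≤ n → n ≤ j.val → Y.d ⟨n, hn⟩ = Y.d i := by
    intro n hn hin
    induction n, hin using Nat.le_induction with
    | base => intro _; rfl
    | succ n hin ih =>
      intro hj
      rw [← ih (by omega) (by omega)]
      have hk := key ⟨n, by omega⟩
      have e1 : (⟨n, by omega⟩ : Fin m).castSucc = ⟨n, by omega⟩ := rfl
      have e2 : (⟨n, by omega⟩ : Fin m).succ = ⟨n + 1, hn⟩ := rfl
      rcases src_tgt (ε := ε) ⟨n, by omega⟩ with ⟨a, b⟩ | ⟨a, b⟩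
      · rw [a, b, e1, e2] at hk
        refine (hk ?_ ?_).symm <;> simp only [Fin.le_def] <;> omega
      · rw [a, b, e1, e2] at hk
        refine (hk ?_ ?_) <;> simp only [Fin.le_def] <;> omega
  have c1 := const v1 v1.2 hv1.1 hv1.2
  have c2 := const v2 v2.2 hv2.1 hv2.2
  have d1 := hd' v1
  have d2 := hd' v2
  rw [if_pos hv1] at d1
  rw [if_pos hv2] at d2
  simp only [Fin.eta] at c1 c2
  omega

end ChainQuiver

namespace ChainQuiver

variable {m : ℕ} {ε : Fin m → Bool}

/-- Families compatible along the edge `i`. -/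
def Dedge (X : Rep m ε) (i : Fin m) : Submodule ℂ (∀ v, Fin (X.d v) → ℂ) :=
  LinearMap.eqLocus
    ((X.A i).mulVecLin.comp (LinearMap.proj (R := ℂ) (φ := fun v => Fin (X.d v) → ℂ) (src ε i)))
    (LinearMap.proj (R := ℂ) (φ := fun v => Fin (X.d v) → ℂ) (tgt ε i))

theorem mem_Dedge (X : Rep m ε) (i : Fin m) (w : ∀ v, Fin (X.d v) → ℂ) :
    w ∈ Dedge X i ↔ X.A i *ᵥ w (src ε i) = w (tgt ε i) := Iff.rfl

theorem src_ne_tgt (i : Fin m) : src ε i ≠ tgt ε i := by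
  rcases src_tgt (ε := ε) i with ⟨a, b⟩ | ⟨a, b⟩ <;> rw [a, b] <;> simp [Fin.ext_iff]

theorem Dedge_local (X : Rep m ε) (i : Fin m) (w : ∀ v, Fin (X.d v) → ℂ) (hw : w ∈ Dedge X i)
    (w' : ∀ v, Fin (X.d v) → ℂ) (h1 : w' i.castSucc = w i.castSucc)
    (h2 : w' i.succ = w i.succ) : w' ∈ Dedge X i := by
  have hh : ∀ v, v = i.castSucc ∨ v = i.succ → w' v = w v := by
    rintro v (rfl | rfl) <;> assumption
  rw [mem_Dedge] at hw ⊢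
  have := src_tgt (ε := ε) i
  rw [hh (src ε i) (by tauto), hh (tgt ε i) (by tauto), hw]

theorem dual_compat (X : Rep m ε) (i : Fin m) (ψ : ∀ v, Module.Dual ℂ (Fin (X.d v) → ℂ))
    (h : ∀ w ∈ Dedge X i, ψ i.castSucc (w i.castSucc) = ψ i.succ (w i.succ))
    (u : Fin (X.d (src ε i)) → ℂ) : ψ (tgt ε i) (X.A i *ᵥ u) = ψ (src ε i) u := by
  let w : ∀ v, Fin (X.d v) → ℂ :=
    Function.update (Function.update 0 (src ε i) u) (tgt ε i) (X.A i *ᵥ u)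
  have w1 : w (src ε i) = u := by
    simp only [w]
    rw [Function.update_of_ne (src_ne_tgt i), Function.update_self]
  have w2 : w (tgt ε i) = X.A i *ᵥ u := Function.update_self _ _ _
  have hw := h w (by rw [mem_Dedge, w1, w2])
  have : ψ (tgt ε i) (w (tgt ε i)) = ψ (src ε i) (w (src ε i)) := by
    rcases src_tgt (ε := ε) i with ⟨a, b⟩ | ⟨a, b⟩ <;> rw [a, b, hw]
  rwa [w1, w2] at this

theorem exists_split (X : Rep m ε) (hX : Nonzero X) :
    ∃ (p j : Fin (m + 1)) (x : ∀ v, Fin (X.d v) → ℂ)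
      (ψ : ∀ v, Module.Dual ℂ (Fin (X.d v) → ℂ)), p ≤ j ∧ (∀ v, v < p → X.d v = 0) ∧
      ψ p (x p) = 1 ∧
      (∀ i : Fin m, p ≤ i.castSucc → i.succ ≤ j → X.A i *ᵥ x (src ε i) = x (tgt ε i) ∧
        ∀ u, ψ (tgt ε i) (X.A i *ᵥ u) = ψ (src ε i) u) ∧
      (∀ i : Fin m, i.castSucc = j → (ε i = true → X.A i *ᵥ x (src ε i) = 0) ∧
        (ε i = false → ∀ u, ψ (tgt ε i) (X.A i *ᵥ u) = 0)) := by
  classical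
  have hex : ∃ n, ∃ h : n < m + 1, X.d ⟨n, h⟩ ≠ 0 := by
    obtain ⟨v, hv⟩ := hX
    exact ⟨v, v.2, hv⟩
  obtain ⟨p, ⟨hp, hpd⟩, hpmin⟩ : ∃ p, (∃ h : p < m + 1, X.d ⟨p, h⟩ ≠ 0) ∧
      ∀ v : Fin (m + 1), v.val < p → X.d v = 0 := by
    refine ⟨Nat.find hex, Nat.find_spec hex, fun v hv => ?_⟩
    have := Nat.find_min hex hv
    by_contra h0
    exact this ⟨v.2, h0⟩
  let D := Dedge X
  have hD : ∀ i, ∀ w ∈ D i, ∀ w' : (∀ v, Fin (X.d v) → ℂ), w' i.castSucc = w i.castSucc →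
      w' i.succ = w i.succ → w' ∈ D i := Dedge_local X
  let G : ℕ → Prop := fun n => p ≤ n ∧ ∃ hn : n < m + 1, ∃ x ∈ Cn D p n,
    ∀ x' ∈ Cn D p n, x' ⟨n, hn⟩ = 0 → x' ⟨p, hp⟩ ≠ x ⟨p, hp⟩
  have Gp : G p := by
    refine ⟨le_rfl, hp, fun _ => 1, ?_, ?_⟩
    · rw [mem_Cn]; intros; omega
    · intro x' _ h0 h1
      rw [h0] at h1
      have := congrFun h1 ⟨0, Nat.pos_of_ne_zero hpd⟩
      simp at this
  obtain ⟨j, ⟨hpj, hj, x, hx, hxK⟩, hmax⟩ : ∃ j, G j ∧ ∀ n, j < n → ¬ G n := by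
    refine ⟨Nat.findGreatest G m, Nat.findGreatest_spec (by omega : p ≤ m) Gp, ?_⟩
    intro n hn hG
    obtain ⟨_, hnm, _⟩ := id hG
    exact Nat.findGreatest_is_greatest hn (by omega) hG
  let K : Submodule ℂ (Fin (X.d ⟨p, hp⟩) → ℂ) :=
    (Cn D p j ⊓ LinearMap.ker
      (LinearMap.proj (R := ℂ) (φ := fun v => Fin (X.d v) → ℂ) ⟨j, hj⟩)).map
      (LinearMap.proj (R := ℂ) (φ := fun v => Fin (X.d v) → ℂ) ⟨p, hp⟩)
  have memK : ∀ x' ∈ Cn D p j, x' ⟨j, hj⟩ = 0 → x' ⟨p, hp⟩ ∈ K := by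
    intro x' h1 h2
    exact ⟨x', ⟨h1, h2⟩, rfl⟩
  have hxK' : x ⟨p, hp⟩ ∉ K := by
    rintro ⟨x', ⟨h1, h2⟩, h3⟩
    exact hxK x' h1 h2 h3
  obtain ⟨φ, hφ1, hφK⟩ := sep K _ hxK'
  have Cmono : ∀ y, y ∈ Cn D p (j+1) → y ∈ Cn D p j := by
    intro y hy
    rw [mem_Cn] at hy ⊢
    intro i h1 h2
    exact hy i h1 (by omega)
  -- the common conclusion, when no dual boundary condition arises
  have fin1 : ∀ y ∈ Cn D p j, y ⟨p, hp⟩ = x ⟨p, hp⟩ →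
      (∀ i : Fin m, i.val = j → ε i = true ∧ X.A i *ᵥ y (src ε i) = 0) →
      ∃ (p j : Fin (m + 1)) (x : ∀ v, Fin (X.d v) → ℂ)
      (ψ : ∀ v, Module.Dual ℂ (Fin (X.d v) → ℂ)), p ≤ j ∧ (∀ v, v < p → X.d v = 0) ∧
      ψ p (x p) = 1 ∧
      (∀ i : Fin m, p ≤ i.castSucc → i.succ ≤ j → X.A i *ᵥ x (src ε i) = x (tgt ε i) ∧
        ∀ u, ψ (tgt ε i) (X.A i *ᵥ u) = ψ (src ε i) u) ∧
      (∀ i : Fin m, i.castSucc = j → (ε i = true → X.A i *ᵥ x (src ε i) = 0) ∧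
        (ε i = false → ∀ u, ψ (tgt ε i) (X.A i *ᵥ u) = 0)) := by
    intro y hy hyx hb
    obtain ⟨ψ, h1, h2⟩ := extend_dual' D hD p hp j hpj hj φ
      (fun x' hx' h0 => hφK _ (memK x' hx' h0))
    refine ⟨⟨p, hp⟩, ⟨j, hj⟩, y, ψ, hpj, fun v hv => hpmin v hv, ?_, ?_, ?_⟩
    · rw [h1, hyx, hφ1]
    · intro i hi1 hi2
      rw [mem_Cn] at hy
      exact ⟨hy i hi1 hi2, dual_compat X i ψ (h2 i hi1 hi2)⟩
    · intro i hi
      have := hb i (congrArg Fin.val hi)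
      exact ⟨fun _ => this.2, fun h => by simp [this.1] at h⟩
  by_cases hjm : j = m
  · refine fin1 x hx rfl ?_
    intro i hi
    have := i.2
    omega
  have hjlt : j < m := by omega
  let k : Fin m := ⟨j, hjlt⟩
  have hnG := hmax (j+1) (by omega)
  have hIK : ∀ y ∈ Cn D p (j+1), ∃ x' ∈ Cn D p (j+1), x' ⟨j+1, by omega⟩ = 0 ∧
      x' ⟨p, hp⟩ = y ⟨p, hp⟩ := by
    intro y hy
    by_contra hcon
    apply hnG
    refine ⟨by omega, by omega, y, hy, ?_⟩
    intro x' hx' h0 h1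
    exact hcon ⟨x', hx', h0, h1⟩
  rcases hε : ε k with _ | _
  · -- backward arrow
    have hs : src ε k = ⟨j+1, by omega⟩ := by simp [src, hε, k]
    have ht : tgt ε k = ⟨j, hj⟩ := by simp [tgt, hε, k]
    obtain ⟨ψ, h1, h2, h3⟩ := extend_dual D hD p hp (j+1) (by omega) (by omega) φ 0 (by
      intro y hy
      obtain ⟨x', hx', h0, h1⟩ := hIK y hy
      rw [← h1]
      simp only [LinearMap.zero_apply]
      apply hφK
      apply memK _ (Cmono _ hx')
      rw [mem_Cn] at hx'
      have hk := hx' k hpj le_rfl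
      have e1 : x' (src ε k) = 0 := by rw [hs]; exact h0
      have e2 : x' (tgt ε k) = 0 := by
        rw [← (mem_Dedge X k x').1 hk, e1, Matrix.mulVec_zero]
      rw [ht] at e2
      exact e2)
    refine ⟨⟨p, hp⟩, ⟨j, hj⟩, x, ψ, hpj, fun v hv => hpmin v hv, ?_, ?_, ?_⟩
    · rw [h1, hφ1]
    · intro i hi1 hi2
      rw [mem_Cn] at hx
      exact ⟨hx i hi1 hi2, dual_compat X i ψ (h3 i hi1 (Nat.le_succ_of_le hi2))⟩
    · intro i hi
      have hi' : i.val = j := congrArg Fin.val hi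
      obtain rfl : i = k := Fin.ext hi'
      refine ⟨fun h => by simp [hε] at h, fun _ u => ?_⟩
      rw [dual_compat X k ψ (h3 k hpj le_rfl)]
      have e0 : ψ (src ε k) = 0 := by rw [hs]; exact h2
      rw [e0]; rfl
  · -- forward arrow
    have ht : tgt ε k = ⟨j+1, by omega⟩ := by simp [tgt, hε, k]
    let y : ∀ v, Fin (X.d v) → ℂ :=
      Function.update x (tgt ε k) (X.A k *ᵥ x (src ε k))
    have hy : y ∈ Cn D p (j+1) := by
      rw [mem_Cn] at hx ⊢
      intro i h1 h2
      by_cases hik : i.val = j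
      · obtain rfl : i = k := Fin.ext hik
        refine (mem_Dedge X k y).2 ?_
        simp only [y]
        rw [Function.update_self, Function.update_of_ne (src_ne_tgt k)]
      · refine hD i x (hx i h1 (by omega)) y ?_ ?_
        · simp only [y]
          rw [Function.update_of_ne]
          rw [ht]; simp [Fin.ext_iff]; omega
        · simp only [y]
          rw [Function.update_of_ne]
          rw [ht]; simp [Fin.ext_iff]; omega
    have hyp : y ⟨p, hp⟩ = x ⟨p, hp⟩ := by
      simp only [y]
      rw [Function.update_of_ne]
      rw [ht]; simp [Fin.ext_iff]; omega
    obtain ⟨x', hx', h0, h1⟩ := hIK y hy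
    refine fin1 x' (Cmono _ hx') (h1.trans hyp) ?_
    intro i hi
    obtain rfl : i = k := Fin.ext hi
    refine ⟨hε, ?_⟩
    rw [mem_Cn] at hx'
    rw [(mem_Dedge X k x').1 (hx' k hpj le_rfl), ht]
    exact h0

theorem indec_interval (X : Rep m ε) (hX : Indecomposable X) :
    ∃ i j : Fin (m + 1), i ≤ j ∧ Iso X (interval ε i j) := by
  classical
  obtain ⟨p, j, x, ψ, hpj, hlow, h1, hin, hbd⟩ := exists_split X hX.1
  have hone : ∀ n (hn : n < m + 1), p.val ≤ n → n ≤ j.val → ψ ⟨n, hn⟩ (x ⟨n, hn⟩) = 1 := by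
    intro n hn hpn
    induction n, hpn using Nat.le_induction with
    | base => intro _; exact h1
    | succ n hpn ih =>
      intro hnj
      have i0 := ih (by omega) (by omega)
      let k : Fin m := ⟨n, by omega⟩
      obtain ⟨a, b⟩ := hin k hpn hnj
      have hb := b (x (src ε k))
      rw [a] at hb
      rcases src_tgt (ε := ε) k with ⟨c, d⟩ | ⟨c, d⟩
      · rw [c, d] at hb
        exact hb.trans i0
      · rw [c, d] at hb
        exact hb.symm.trans i0
  have hone' : ∀ v, (p ≤ v ∧ v ≤ j) → ψ v (x v) = 1 := fun v hv => hone v v.2 hv.1 hv.2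
  -- the projector
  let I : Fin (m+1) → Prop := fun v => p ≤ v ∧ v ≤ j
  let E : ∀ v, (Fin (X.d v) → ℂ) →ₗ[ℂ] (Fin (X.d v) → ℂ) := fun v =>
    if I v then (ψ v).smulRight (x v) else 0
  have Ein : ∀ v, I v → ∀ u, E v u = ψ v u • x v := fun v hv u => by simp [E, hv]
  have Eout : ∀ v, ¬ I v → ∀ u, E v u = 0 := fun v hv u => by simp [E, hv]
  have Eid : ∀ v, E v ∘ₗ E v = E v := by
    intro v
    apply LinearMap.ext
    intro u
    rw [LinearMap.comp_apply]
    by_cases hv : I v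
    · simp [Ein v hv, hone' v hv]
    · simp [Eout v hv]
  have edge : ∀ i, I (src ε i) → I (tgt ε i) → X.A i *ᵥ x (src ε i) = x (tgt ε i) ∧
      ∀ u, ψ (tgt ε i) (X.A i *ᵥ u) = ψ (src ε i) u := fun i hs ht => hin i
    (by rcases src_tgt (ε := ε) i with ⟨c, d⟩ | ⟨c, d⟩
        · rw [← c]; exact hs.1
        · rw [← d]; exact ht.1)
    (by rcases src_tgt (ε := ε) i with ⟨c, d⟩ | ⟨c, d⟩
        · rw [← d]; exact ht.2
        · rw [← c]; exact hs.2)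
  have Ecomm : ∀ i u, E (tgt ε i) (X.A i *ᵥ u) = X.A i *ᵥ (E (src ε i) u) := by
    intro i u
    by_cases hs : I (src ε i) <;> by_cases ht : I (tgt ε i)
    · obtain ⟨a, b⟩ := edge i hs ht
      rw [Ein _ hs, Ein _ ht, b, Matrix.mulVec_smul, a]
    · rw [Ein _ hs, Eout _ ht, Matrix.mulVec_smul]
      by_cases hlt : tgt ε i < p
      · have h0 := hlow _ hlt
        ext a
        have := a.2
        omega
      · have hε : ε i = true ∧ i.castSucc = j := by
          rcases hh : ε i with _ | _
          · simp only [I, src, tgt, hh, Fin.le_def, Fin.lt_def] at hs ht hlt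
            simp at hs ht hlt
            omega
          · simp only [I, src, tgt, hh, Fin.le_def, Fin.lt_def] at hs ht hlt
            simp at hs ht hlt
            simp [Fin.ext_iff]
            omega
        rw [(hbd i hε.2).1 hε.1, smul_zero]
    · rw [Eout _ hs, Ein _ ht, Matrix.mulVec_zero]
      by_cases hlt : src ε i < p
      · have h0 := hlow _ hlt
        have hu : u = 0 := by
          ext a
          have := a.2
          omega
        simp [hu]
      · have hε : ε i = false ∧ i.castSucc = j := by
          rcases hh : ε i with _ | _
          · simp only [I, src, tgt, hh, Fin.le_def, Fin.lt_def] at hs ht hlt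
            simp at hs ht hlt
            simp [Fin.ext_iff]
            omega
          · simp only [I, src, tgt, hh, Fin.le_def, Fin.lt_def] at hs ht hlt
            simp at hs ht hlt
            omega
        rw [(hbd i hε.2).2 hε.1, zero_smul]
    · rw [Eout _ hs, Eout _ ht, Matrix.mulVec_zero]
  have Eone := idem_split X hX (fun v => LinearMap.toMatrix' (E v))
    (fun v => by rw [← LinearMap.toMatrix'_comp, Eid])
    (fun i => by
      apply Matrix.toLin'.injective
      apply LinearMap.ext
      intro u
      simp only [Matrix.toLin'_mul, LinearMap.comp_apply, Matrix.toLin'_toMatrix',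
        Matrix.toLin'_apply, Ecomm])
    ⟨p, fun h0 => by
      have hE : E p = 0 := LinearMap.toMatrix'.injective (by simpa using h0)
      have hp : I p := ⟨le_rfl, hpj⟩
      have h2 := Ein p hp (x p)
      rw [hE, h1, one_smul] at h2
      rw [← h2] at h1
      simp at h1⟩
  have hid : ∀ v u, E v u = u := by
    intro v u
    have h2 := congrArg Matrix.toLin' (Eone v)
    rw [Matrix.toLin'_toMatrix', Matrix.toLin'_one] at h2
    rw [h2]; rfl
  have dot : ∀ v (u : Fin (X.d v) → ℂ), ∑ a, ψ v (Pi.single a 1) * u a = ψ v u := by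
    intro v u
    conv_rhs => rw [pi_eq_sum_univ' u, map_sum]
    refine Finset.sum_congr rfl fun a _ => ?_
    rw [map_smul, smul_eq_mul, mul_comm]
  have dI : ∀ v, Fin ((interval ε p j).d v) → I v := by
    intro v a
    by_contra hv
    have h2 := a.2
    have h4 : (interval ε p j).d v = 0 := if_neg hv
    omega
  refine ⟨p, j, hpj, fun v => Matrix.of fun _ a => ψ v (Pi.single a 1),
    fun v => Matrix.of fun a _ => x v a, ?_, ?_, ?_⟩
  · intro v
    ext a b
    have hv := dI v a
    have hab : a = b := by
      have h2 := a.2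
      have h3 := b.2
      have h4 : (interval ε p j).d v = 1 := if_pos hv
      apply Fin.ext
      omega
    subst hab
    rw [Matrix.one_apply_eq, Matrix.mul_apply]
    exact (dot v (x v)).trans (hone' v hv)
  · intro v
    ext a b
    rw [Matrix.mul_apply]
    have h2 := congrFun (hid v (Pi.single b 1)) a
    have h3 : (1 : Matrix (Fin (X.d v)) (Fin (X.d v)) ℂ) a b =
        (Pi.single b (1 : ℂ) : Fin (X.d v) → ℂ) a := by
      rw [Matrix.one_apply, Pi.single_apply]
    rw [h3, ← h2]
    simp only [Matrix.of_apply, Finset.sum_const, Finset.card_univ, Fintype.card_fin]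
    by_cases hv : I v
    · have h4 : (interval ε p j).d v = 1 := if_pos hv
      rw [h4, Ein v hv]
      simp [mul_comm]
    · have h4 : (interval ε p j).d v = 0 := if_neg hv
      rw [h4, Eout v hv]
      simp
  · intro i
    ext a b
    have ht := dI _ a
    have hs := dI _ b
    have hb := (edge i hs ht).2 (x (src ε i))
    rw [hone' _ hs] at hb
    rw [Matrix.mul_assoc, Matrix.mul_apply]
    exact (hb.symm.trans (dot _ _).symm)

/-- A matrix representation of the chain quiver (with `t = m + 1 ≥ 1` vertices and
arbitrary orientation `ε`) is indecomposable if and only if it is isomorphic to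
`L_{ij}` for some `i ≤ j`. -/
theorem chain_indecomposable_iff (m : ℕ) (ε : Fin m → Bool) (X : Rep m ε) :
    Indecomposable X ↔ ∃ i j : Fin (m + 1), i ≤ j ∧ Iso X (interval ε i j) :=
  ⟨indec_interval X, fun ⟨i, j, hij, h⟩ => interval_indec X i j hij h⟩

end ChainQuiver
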